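/- arXiv:2503.00251 — 3 statements merged into one kernel-verified Lean document; each statement's English description precedes it below -/
import Mathlib

section
/- Let x ≠ y be two states and suppose q(y|x) > 0, q(x|y) > 0, f_c(x) > 0, f_c(y) > 0, f_f(x) > 0, f_f(y) > 0 are real numbers. Define the first-stage acceptance probability g(x,y) = min{1, (f_c(y) q(x|y)) / (f_c(x) q(y|x))} and the effective proposal q*(y|x) = g(x,y) q(y|x) (and symmetrically q*(x|y) = g(y,x) q(x|y)). Then the second-stage acceptance probability of the Two-Stage Delayed Acceptance method simplifies, independently of q: min{1, (q*(x|y) f_f(y)) / (q*(y|x) f_f(x))} = min{1, (f_f(y) f_c(x)) / (f_f(x) f_c(y))}. -/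
/-- Two-Stage Delayed Acceptance: the second-stage acceptance probability
simplifies independently of the proposal `q`.  Here `q y x` denotes the
proposal density `q(y|x)`, `fc` the coarse and `ff` the fine target density.
`g(x,y) = min {1, (fc y * q x y) / (fc x * q y x)}` is the first-stage
acceptance probability and `q*(y|x) = g(x,y) * q y x` the effective proposal. -/
theorem two_stage_acceptance_simplification
    {S : Type*} (x y : S) (hxy : x ≠ y)
    (q : S → S → ℝ) (fc ff : S → ℝ)
    (hqyx : 0 < q y x) (hqxy : 0 < q x y)
    (hfcx : 0 < fc x) (hfcy : 0 < fc y)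
    (hffx : 0 < ff x) (hffy : 0 < ff y) :
    min 1 ((min 1 ((fc x * q y x) / (fc y * q x y)) * q x y * ff y) /
           (min 1 ((fc y * q x y) / (fc x * q y x)) * q y x * ff x)) =
    min 1 ((ff y * fc x) / (ff x * fc y)) := by
  have ha : 0 < fc x * q y x := mul_pos hfcx hqyx
  have hb : 0 < fc y * q x y := mul_pos hfcy hqxy
  congr 1
  rcases le_total (fc x * q y x) (fc y * q x y) with h | h
  · rw [min_eq_right ((div_le_one hb).2 h), min_eq_left ((one_le_div ha).2 h)]
    field_simp
  · rw [min_eq_left ((one_le_div hb).2 h), min_eq_right ((div_le_one ha).2 h)]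
    field_simp
end

section
/- Let C be a symmetric positive definite n×n real matrix, let β be a real number with 0 < β ≤ 1, and set s = √(1 − β²). Define the preconditioned Crank-Nicolson proposal density kernel k(y|x) = exp( −(1/(2β²)) (y − s·x)ᵀ C⁻¹ (y − s·x) ) and the (unnormalized) Gaussian prior density π(x) = exp( −(1/2) xᵀ C⁻¹ x ). Then for all x, y ∈ ℝⁿ: k(x|y) / k(y|x) = π(x) / π(y). -/
open Matrix

/-- For a symmetric positive definite covariance matrix `C`, `0 < β ≤ 1` and
`s = √(1 - β²)`, the preconditioned Crank–Nicolson proposal density kernel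
`k(y|x) = exp(-(1/(2β²)) (y - s·x)ᵀ C⁻¹ (y - s·x))` and the unnormalized
Gaussian prior `pr(x) = exp(-(1/2) xᵀ C⁻¹ x)` satisfy
`k(x|y) / k(y|x) = pr(x) / pr(y)`.  Here `k u v` denotes `k(u|v)`. -/
theorem pCN_proposal_ratio_eq_prior_ratio {n : ℕ}
    (C : Matrix (Fin n) (Fin n) ℝ) (hC : C.PosDef)
    (β : ℝ) (hβ0 : 0 < β) (hβ1 : β ≤ 1)
    (k : (Fin n → ℝ) → (Fin n → ℝ) → ℝ) (pr : (Fin n → ℝ) → ℝ)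
    (hk : ∀ u v, k u v =
      Real.exp (-(1 / (2 * β ^ 2)) *
        ((u - Real.sqrt (1 - β ^ 2) • v) ⬝ᵥ (C⁻¹ *ᵥ (u - Real.sqrt (1 - β ^ 2) • v)))))
    (hpr : ∀ u, pr u = Real.exp (-(1 / 2) * (u ⬝ᵥ (C⁻¹ *ᵥ u))))
    (x y : Fin n → ℝ) :
    k x y / k y x = pr x / pr y := by
  have hs : Real.sqrt (1 - β ^ 2) ^ 2 = 1 - β ^ 2 :=
    Real.sq_sqrt (by nlinarith)
  rw [hk, hk, hpr, hpr, ← Real.exp_sub, ← Real.exp_sub]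
  congr 1
  generalize Real.sqrt (1 - β ^ 2) = s at hs
  simp only [Matrix.mulVec_sub, Matrix.mulVec_smul, sub_dotProduct, dotProduct_sub,
    smul_dotProduct, dotProduct_smul, smul_eq_mul]
  generalize x ⬝ᵥ (C⁻¹ *ᵥ x) = a
  generalize y ⬝ᵥ (C⁻¹ *ᵥ y) = b
  generalize x ⬝ᵥ (C⁻¹ *ᵥ y) = c
  generalize y ⬝ᵥ (C⁻¹ *ᵥ x) = d
  have hβ : β ≠ 0 := hβ0.ne'
  field_simp
  linear_combination (a - b) * hs
end

section
/- Let Ω ⊂ ℝ be partitioned into R₁, R₂, R₃, R₄ where R₂ = {p} and R₃ = {p + h} are single grid points, let λ₁, λ₂ ≥ 0 and Ψ₁, Ψ₂ : ℝ → ℝ be given functions, and define V as the set of functions η : Ω → ℝ for which there exist real numbers a, b, c, d, e, g with η(x) = √λ₁ Ψ₁(x) e on R₁, η(x) = √λ₁ Ψ₁(x) a + √λ₂ Ψ₂(x + h) b on R₂, η(x) = √λ₁ Ψ₁(x − h) c + √λ₂ Ψ₂(x) d on R₃, and η(x) = √λ₂ Ψ₂(x) g on R₄. For θ ∈ ℝ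 define the local-averaging update operators: T₁^θ(η)(x) = √λ₁ Ψ₁(x) θ on R₁, T₁^θ(η)(x) = (1/2)(√λ₁ Ψ₁(x) θ + η(x + h)) on R₂, and T₁^θ(η) = η on R₃ ∪ R₄; symmetrically T₂^θ(η) = η on R₁ ∪ R₂, T₂^θ(η)(x) = (1/2)(η(x − h) + √λ₂ Ψ₂(x) θ) on R₃, and T₂^θ(η)(x) = √λ₂ Ψ₂(x) θ on R₄. Then: (i) V is invariant under T₁^θ and T₂^θ for every θ ∈ ℝ; explicitly, if η has coefficients (a, b, c, d, e, g) then T₁^θ(η) has R₂-coefficients a' = (θ + c)/2, b' = d/2, and T₂^θ(η) has R₃-coefficients c' = a/2, d' = (θ + b)/2; and (ii) if the initial field η⁰ is given by η⁰(x) = √λ₁ Ψ₁(x) θ₁⁰ on R₁ ∪ R₂ and η⁰(x) = √λ₂ Ψ₂(x) θ₂⁰ on R₃ ∪ R₄, then any field obtained from η⁰ by a finite sequence of updates from {T₁^θ : θ ∈ ℝ} ∪ {T₂^θ : θ ∈ ℝ} that contains at least one T₁ update and at least one T₂ update belongs to V; in particular there exist a, b, c, d ∈ ℝ such that the field equals √λ₁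 Ψ₁(x) a + √λ₂ Ψ₂(x+h) b on R₂ and √λ₁ Ψ₁(x−h) c + √λ₂ Ψ₂(x) d on R₃. -/
open Classical in
/-- The local-averaging update with active subdomain `Ω₁ = R₁ ∪ R₂`: the field
is replaced by `√λ₁ Ψ₁(x) θ` on `R₁`, averaged with the previous field's value
at the adjacent point on `R₂`, and left unchanged elsewhere. -/
noncomputable def T1 (R1 R2 : Set ℝ) (lam1 : ℝ) (Ψ1 : ℝ → ℝ) (h θ : ℝ)
    (η : ℝ → ℝ) : ℝ → ℝ := fun x =>
  if x ∈ R1 then Real.sqrt lam1 * Ψ1 x * θ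
  else if x ∈ R2 then (1 / 2) * (Real.sqrt lam1 * Ψ1 x * θ + η (x + h))
  else η x

open Classical in
/-- The local-averaging update with active subdomain `Ω₂ = R₃ ∪ R₄`: the field
is averaged with the previous field's value at the adjacent point on `R₃`,
replaced by `√λ₂ Ψ₂(x) θ` on `R₄`, and left unchanged elsewhere. -/
noncomputable def T2 (R3 R4 : Set ℝ) (lam2 : ℝ) (Ψ2 : ℝ → ℝ) (h θ : ℝ)
    (η : ℝ → ℝ) : ℝ → ℝ := fun x =>
  if x ∈ R3 then (1 / 2) * (η (x - h) + Real.sqrt lam2 * Ψ2 x * θ)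
  else if x ∈ R4 then Real.sqrt lam2 * Ψ2 x * θ
  else η x

/-- `η` has coefficients `(a, b, c, d, e, g)` on the four regions. -/
def HasCoeffs (R1 R2 R3 R4 : Set ℝ) (lam1 lam2 h : ℝ) (Ψ1 Ψ2 : ℝ → ℝ)
    (η : ℝ → ℝ) (a b c d e g : ℝ) : Prop :=
  (∀ x ∈ R1, η x = Real.sqrt lam1 * Ψ1 x * e) ∧
  (∀ x ∈ R2, η x = Real.sqrt lam1 * Ψ1 x * a + Real.sqrt lam2 * Ψ2 (x + h) * b) ∧
  (∀ x ∈ R3, η x = Real.sqrt lam1 * Ψ1 (x - h) * c + Real.sqrt lam2 * Ψ2 x * d) ∧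
  (∀ x ∈ R4, η x = Real.sqrt lam2 * Ψ2 x * g)

/-- The equivalent state space `V` of the locally averaged multiscale method. -/
def InV (R1 R2 R3 R4 : Set ℝ) (lam1 lam2 h : ℝ) (Ψ1 Ψ2 : ℝ → ℝ)
    (η : ℝ → ℝ) : Prop :=
  ∃ a b c d e g : ℝ, HasCoeffs R1 R2 R3 R4 lam1 lam2 h Ψ1 Ψ2 η a b c d e g

/-- The state space of the locally averaged Multiscale Sampling Method:
(i) `V` is invariant under the local-averaging updates `T1` and `T2`, with the
explicit coefficient transformations `a' = (θ + c)/2`, `b' = d/2` for `T1` and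
`c' = a/2`, `d' = (θ + b)/2` for `T2`; and
(ii) any field obtained from the initial field `η⁰` by a finite sequence of
updates containing at least one `T1`- and at least one `T2`-update lies in
`V`; in particular there are `a, b, c, d` giving the stated form on `R₂`
and `R₃`. -/
theorem locally_averaged_state_space
    (R1 R2 R3 R4 : Set ℝ) (lam1 lam2 : ℝ)
    (hlam1 : 0 ≤ lam1) (hlam2 : 0 ≤ lam2)
    (Ψ1 Ψ2 : ℝ → ℝ) (p h : ℝ)
    (hR2 : R2 = {p}) (hR3 : R3 = {p + h})
    (h12 : Disjoint R1 R2) (h13 : Disjoint R1 R3) (h14 : Disjoint R1 R4)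
    (h23 : Disjoint R2 R3) (h24 : Disjoint R2 R4) (h34 : Disjoint R3 R4)
    (θ10 θ20 : ℝ) (η0 : ℝ → ℝ)
    (hη0a : ∀ x ∈ R1 ∪ R2, η0 x = Real.sqrt lam1 * Ψ1 x * θ10)
    (hη0b : ∀ x ∈ R3 ∪ R4, η0 x = Real.sqrt lam2 * Ψ2 x * θ20) :
    (∀ θ a b c d e g η, HasCoeffs R1 R2 R3 R4 lam1 lam2 h Ψ1 Ψ2 η a b c d e g →
        HasCoeffs R1 R2 R3 R4 lam1 lam2 h Ψ1 Ψ2 (T1 R1 R2 lam1 Ψ1 h θ η)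
          ((θ + c) / 2) (d / 2) c d θ g ∧
        HasCoeffs R1 R2 R3 R4 lam1 lam2 h Ψ1 Ψ2 (T2 R3 R4 lam2 Ψ2 h θ η)
          a b (a / 2) ((θ + b) / 2) e θ) ∧
    (∀ L : List (Bool × ℝ),
        (∃ θ, (true, θ) ∈ L) → (∃ θ, (false, θ) ∈ L) →
        InV R1 R2 R3 R4 lam1 lam2 h Ψ1 Ψ2
          (L.foldl (fun η u =>
            if u.1 then T1 R1 R2 lam1 Ψ1 h u.2 η
            else T2 R3 R4 lam2 Ψ2 h u.2 η) η0)) := by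
  subst hR2 hR3
  have hp1 : p ∉ R1 := fun hx => Set.disjoint_left.mp h12 hx rfl
  have hq1 : p + h ∉ R1 := fun hx => Set.disjoint_left.mp h13 hx rfl
  have hp4 : p ∉ R4 := fun hx => Set.disjoint_left.mp h24 rfl hx
  have hq4 : p + h ∉ R4 := fun hx => Set.disjoint_left.mp h34 rfl hx
  have hpq : p ≠ p + h := fun hx => Set.disjoint_left.mp h23 rfl hx
  have key : ∀ θ a b c d e g η,
      HasCoeffs R1 {p} {p + h} R4 lam1 lam2 h Ψ1 Ψ2 η a b c d e g →
        HasCoeffs R1 {p} {p + h} R4 lam1 lam2 h Ψ1 Ψ2 (T1 R1 {p} lam1 Ψ1 h θ η)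
          ((θ + c) / 2) (d / 2) c d θ g ∧
        HasCoeffs R1 {p} {p + h} R4 lam1 lam2 h Ψ1 Ψ2 (T2 {p + h} R4 lam2 Ψ2 h θ η)
          a b (a / 2) ((θ + b) / 2) e θ := by
    rintro θ a b c d e g η ⟨H1, H2, H3, H4⟩
    have e2 := H2 p rfl
    have e3 := H3 (p + h) rfl
    rw [add_sub_cancel_right] at e3
    refine ⟨⟨?_, ?_, ?_, ?_⟩, ⟨?_, ?_, ?_, ?_⟩⟩
    · intro x hx
      simp only [T1, if_pos hx]
    · rintro x rfl
      simp only [T1, if_neg hp1, Set.mem_singleton_iff, if_true, e3]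
      ring
    · rintro x rfl
      simp only [T1, if_neg hq1, Set.mem_singleton_iff, if_neg hpq.symm, e3,
        add_sub_cancel_right]
    · intro x hx
      have hx1 : x ∉ R1 := fun h' => Set.disjoint_left.mp h14 h' hx
      have hxp : x ≠ p := fun h' => hp4 (h' ▸ hx)
      simp only [T1, if_neg hx1, Set.mem_singleton_iff, if_neg hxp, H4 x hx]
    · intro x hx
      have hx4 : x ∉ R4 := fun h' => Set.disjoint_left.mp h14 hx h'
      have hxq : x ≠ p + h := fun h' => hq1 (h' ▸ hx)
      simp only [T2, if_neg hx4, Set.mem_singleton_iff, if_neg hxq, H1 x hx]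
    · rintro x rfl
      simp only [T2, if_neg hp4, Set.mem_singleton_iff, if_neg hpq, e2]
    · rintro x rfl
      simp only [T2, Set.mem_singleton_iff, if_true, add_sub_cancel_right, e2]
      ring
    · intro x hx
      have hxq : x ≠ p + h := fun h' => hq4 (h' ▸ hx)
      simp only [T2, if_pos hx, Set.mem_singleton_iff, if_neg hxq]
  refine ⟨key, ?_⟩
  intro L hL1 hL2
  clear hL1 hL2
  have h0 : InV R1 {p} {p + h} R4 lam1 lam2 h Ψ1 Ψ2 η0 := by
    refine ⟨θ10, 0, 0, θ20, θ10, θ20, ?_, ?_, ?_, ?_⟩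
    · intro x hx
      exact hη0a x (Or.inl hx)
    · intro x hx
      rw [hη0a x (Or.inr hx)]
      ring
    · intro x hx
      rw [hη0b x (Or.inl hx)]
      ring
    · intro x hx
      exact hη0b x (Or.inr hx)
  clear hη0a hη0b
  induction L generalizing η0 with
  | nil => exact h0
  | cons u L ih =>
    rw [List.foldl_cons]
    have h1 : InV R1 {p} {p + h} R4 lam1 lam2 h Ψ1 Ψ2
        (if u.1 then T1 R1 {p} lam1 Ψ1 h u.2 η0 else T2 {p + h} R4 lam2 Ψ2 h u.2 η0) := by
      obtain ⟨a, b, c, d, e, g, H⟩ := h0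
      have K := key u.2 a b c d e g η0 H
      split_ifs
      · exact ⟨_, _, _, _, _, _, K.1⟩
      · exact ⟨_, _, _, _, _, _, K.2⟩
    exact ih _ h1
end
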